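/- arXiv:2306.16063 — 2 statements merged into one kernel-verified Lean document; each statement's English description precedes it below -/
import Mathlib

section
/- Let (E,j) be a soft inductive system of Banach spaces over a directed set N, let x_• be a j-convergent net, and let (x_•^{(α)})_{α∈A} be a net (indexed by a directed set A) of j-convergent nets. Then the following are equivalent: (i) limsup_n ‖x_n − x_n^{(α)}‖ → 0 as α → ∞; (iii) there exist j-convergent nets x̃_•^{(α)} such that x̃_•^{(α)} − x_•^{(α)} is a null net for each α and sup_n ‖x_n − x̃_n^{(α)}‖ → 0 as α → ∞. -/
open Filter Topology MeasureTheory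

variable {N : Type*} [Preorder N] [IsDirected N (· ≤ ·)] [Nonempty N]
variable {E : N → Type*} [∀ n, NormedAddCommGroup (E n)] [∀ n, NormedSpace ℂ (E n)]
  [∀ n, CompleteSpace (E n)]

/-- A *soft inductive system* of Banach spaces over the directed set `N`:
linear contractions `j n m : E m → E n` (for `n ≥ m`, with `j n n = id` and
`j n m = 0` when `¬ m ≤ n`), satisfying
`lim_m limsup_n ‖(j n l - j n m ∘ j m l) x‖ = 0` for all `l` and `x : E l`. -/
structure IsSoftInductiveSystem (j : ∀ n m : N, E m →L[ℂ] E n) : Prop where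
  map_self : ∀ n, j n n = ContinuousLinearMap.id ℂ (E n)
  map_not_le : ∀ n m, ¬ m ≤ n → j n m = 0
  contraction : ∀ n m, m ≤ n → ∀ x : E m, ‖j n m x‖ ≤ ‖x‖
  soft : ∀ (l : N) (x : E l),
    Tendsto (fun m => limsup (fun n => ‖j n l x - j n m (j m l x)‖) atTop)
      atTop (𝓝 0)

/-- A net `x = (x n)_{n ∈ N}` (with `x n ∈ E n`) is uniformly bounded. -/
def UniformlyBounded (x : ∀ n, E n) : Prop := ∃ C : ℝ, ∀ n, ‖x n‖ ≤ C

/-- The seminorm `|‖x‖| = limsup_n ‖x n‖` on uniformly bounded nets. -/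
noncomputable def netSeminorm (x : ∀ n, E n) : ℝ := limsup (fun n => ‖x n‖) atTop

/-- The basic net `j_{• m} ξ` associated with `ξ ∈ E m`. -/
def basicNet (j : ∀ n m : N, E m →L[ℂ] E n) (m : N) (ξ : E m) : ∀ n, E n :=
  fun n => j n m ξ

/-- A uniformly bounded net is `j`-convergent if it lies in the seminorm-closure of
the set of basic nets. -/
def JConvergent (j : ∀ n m : N, E m →L[ℂ] E n) (x : ∀ n, E n) : Prop :=
  UniformlyBounded x ∧
    ∀ ε : ℝ, 0 < ε → ∃ (m : N) (ξ : E m), netSeminorm (fun n => x n - j n m ξ) < ε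

/-- A net is a null net if `lim_n ‖x n‖ = 0`. -/
def IsNullNet (x : ∀ n, E n) : Prop := Tendsto (fun n => ‖x n‖) atTop (𝓝 0)

/-- A realization `(G, L)` of the limit space `E_∞ = C(E,j)/C₀(E,j)` of a soft inductive
system: `L` sends a `j`-convergent net to its `j`-limit; it is linear on `j`-convergent
nets, the norm of a `j`-limit is the seminorm of the net, and every element of `G`
arises as a `j`-limit. -/
structure IsLimitSpace (j : ∀ n m : N, E m →L[ℂ] E n) (G : Type*)
    [NormedAddCommGroup G] [NormedSpace ℂ G] (L : (∀ n, E n) → G) : Prop where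
  map_add : ∀ x y, JConvergent j x → JConvergent j y → L (x + y) = L x + L y
  map_smul : ∀ (c : ℂ) (x), JConvergent j x → L (c • x) = c • L x
  norm_eq : ∀ x, JConvergent j x → ‖L x‖ = netSeminorm x
  surjective : ∀ g : G, ∃ x, JConvergent j x ∧ L x = g

theorem UniformlyBounded.sub {x y : ∀ n, E n} (hx : UniformlyBounded x)
    (hy : UniformlyBounded y) : UniformlyBounded (x - y) := by
  obtain ⟨C, hC⟩ := hx
  obtain ⟨D, hD⟩ := hy
  exact ⟨C + D, fun n => (norm_sub_le _ _).trans (add_le_add (hC n) (hD n))⟩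

theorem IsSoftInductiveSystem.uniformlyBounded_basicNet {j : ∀ n m : N, E m →L[ℂ] E n}
    (hj : IsSoftInductiveSystem j) (m : N) (ξ : E m) : UniformlyBounded (basicNet j m ξ) := by
  refine ⟨‖ξ‖, fun n => ?_⟩
  by_cases h : m ≤ n
  · exact hj.contraction n m h ξ
  · simp [basicNet, hj.map_not_le n m h]

theorem UniformlyBounded.isBoundedUnder_norm {x : ∀ n, E n} (hx : UniformlyBounded x) :
    IsBoundedUnder (· ≤ ·) atTop (fun n => ‖x n‖) :=
  hx.imp fun _ hC => eventually_map.2 (Eventually.of_forall hC)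

theorem UniformlyBounded.eventually_norm_lt {x : ∀ n, E n} (hx : UniformlyBounded x) {c : ℝ}
    (h : netSeminorm x < c) : ∀ᶠ n in atTop, ‖x n‖ < c :=
  eventually_lt_of_limsup_lt h hx.isBoundedUnder_norm

theorem isCoboundedUnder_norm (x : ∀ n, E n) :
    IsCoboundedUnder (· ≤ ·) atTop (fun n => ‖x n‖) :=
  (isBoundedUnder_of ⟨0, fun n => norm_nonneg (x n)⟩ :
    IsBoundedUnder (· ≥ ·) atTop (fun n => ‖x n‖)).isCoboundedUnder_le

theorem netSeminorm_le_of_eventually_le {x : ∀ n, E n} {c : ℝ}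
    (h : ∀ᶠ n in atTop, ‖x n‖ ≤ c) : netSeminorm x ≤ c :=
  limsup_le_of_le (isCoboundedUnder_norm x) h

theorem UniformlyBounded.netSeminorm_nonneg {x : ∀ n, E n} (hx : UniformlyBounded x) :
    0 ≤ netSeminorm x :=
  le_limsup_of_frequently_le (Frequently.of_forall fun n => norm_nonneg (x n))
    hx.isBoundedUnder_norm

/-- Adding a null net does not increase the seminorm. -/
theorem IsNullNet.netSeminorm_le {x y : ∀ n, E n} (h : IsNullNet (y - x))
    (hx : UniformlyBounded x) : netSeminorm y ≤ netSeminorm x := by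
  refine le_of_forall_pos_le_add fun ε hε => netSeminorm_le_of_eventually_le ?_
  filter_upwards [hx.eventually_norm_lt (lt_add_of_pos_right _ (half_pos hε)),
    h.eventually_lt_const (half_pos hε)] with n h₁ h₂
  have h₃ : ‖y n‖ ≤ ‖x n‖ + ‖(y - x) n‖ := norm_le_norm_add_norm_sub' _ _
  linarith

theorem JConvergent.of_isNullNet_sub {j : ∀ n m : N, E m →L[ℂ] E n}
    (hj : IsSoftInductiveSystem j) {x y : ∀ n, E n} (hx : JConvergent j x)
    (hy : UniformlyBounded y) (h : IsNullNet (y - x)) : JConvergent j y := by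
  refine ⟨hy, fun ε hε => ?_⟩
  obtain ⟨m, ξ, hξ⟩ := hx.2 ε hε
  refine ⟨m, ξ, lt_of_le_of_lt ?_ hξ⟩
  have hnull : IsNullNet ((y - basicNet j m ξ) - (x - basicNet j m ξ)) := by
    rwa [sub_sub_sub_cancel_right]
  exact hnull.netSeminorm_le (hx.1.sub (hj.uniformlyBounded_basicNet m ξ))

/-- Radial truncation of a vector to the closed ball of radius `s`. -/
theorem exists_norm_le_and_norm_sub_le {F : Type*} [NormedAddCommGroup F] [NormedSpace ℂ F]
    (d : F) {s : ℝ} (hs : 0 ≤ s) : ∃ e : F, ‖e‖ ≤ s ∧ ‖e - d‖ ≤ max (‖d‖ - s) 0 := by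
  rcases le_or_gt ‖d‖ s with h | h
  · exact ⟨d, h, by simp⟩
  · have hd : 0 < ‖d‖ := hs.trans_lt h
    have hne : ‖d‖ ≠ 0 := ne_of_gt hd
    have hsd : s / ‖d‖ ≤ 1 := (div_le_one hd).2 h.le
    refine ⟨((s / ‖d‖ : ℝ) : ℂ) • d, ?_, le_max_of_le_left ?_⟩
    · rw [norm_smul, Complex.norm_real, Real.norm_of_nonneg (by positivity),
        div_mul_cancel₀ _ hne]
    · have h₁ : ((s / ‖d‖ : ℝ) : ℂ) • d - d = ((s / ‖d‖ - 1 : ℝ) : ℂ) • d := by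
        rw [Complex.ofReal_sub, Complex.ofReal_one, sub_smul, one_smul]
      rw [h₁, norm_smul, Complex.norm_real, Real.norm_of_nonpos (by linarith), neg_sub, sub_mul,
        one_mul, div_mul_cancel₀ _ hne]

/-- A uniformly bounded net differs by a null net from one whose entries are all bounded
by its seminorm. -/
theorem UniformlyBounded.exists_norm_le_netSeminorm {d : ∀ n, E n} (hd : UniformlyBounded d) :
    ∃ e : ∀ n, E n, (∀ n, ‖e n‖ ≤ netSeminorm d) ∧ IsNullNet (e - d) := by
  choose e he hed using fun n => exists_norm_le_and_norm_sub_le (d n) hd.netSeminorm_nonneg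
  refine ⟨e, he, tendsto_order.2 ⟨fun a ha => Eventually.of_forall fun n =>
    ha.trans_le (norm_nonneg _), fun a ha => ?_⟩⟩
  filter_upwards [hd.eventually_norm_lt (lt_add_of_pos_right _ ha)] with n hn
  exact (hed n).trans_lt (max_lt (by linarith) ha)

/-- For a `j`-convergent net `x` and a family `(x^α)` of
`j`-convergent nets indexed by a directed set `A`, seminorm convergence
`limsup_n ‖x n - x^α n‖ → 0` is equivalent to the existence of modified
representatives `x̃^α` (with `x̃^α - x^α` null) converging to `x` uniformly,
i.e. `sup_n ‖x n - x̃^α n‖ → 0`. -/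
theorem seminorm_tendsto_iff_modified_sup_tendsto
    {A : Type*} [Preorder A] [IsDirected A (· ≤ ·)] [Nonempty A]
    (j : ∀ n m : N, E m →L[ℂ] E n) (hj : IsSoftInductiveSystem j)
    (x : ∀ n, E n) (hx : JConvergent j x)
    (xa : A → ∀ n, E n) (hxa : ∀ a, JConvergent j (xa a)) :
    Tendsto (fun a => netSeminorm (x - xa a)) atTop (𝓝 0) ↔
      ∃ xt : A → ∀ n, E n,
        (∀ a, JConvergent j (xt a)) ∧
        (∀ a, IsNullNet (xt a - xa a)) ∧
        Tendsto (fun a => ⨆ n, ‖x n - xt a n‖) atTop (𝓝 0) := by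
  constructor
  · intro h
    have hd a : UniformlyBounded (x - xa a) := hx.1.sub (hxa a).1
    choose e he hnull using fun a => (hd a).exists_norm_le_netSeminorm
    have hxt a : IsNullNet ((x - e a) - xa a) := by
      have h₁ : (x - e a) - xa a = -(e a - (x - xa a)) := by abel
      simpa only [IsNullNet, h₁, Pi.neg_apply, norm_neg] using hnull a
    refine ⟨fun a => x - e a, fun a => (hxa a).of_isNullNet_sub hj
      (hx.1.sub ⟨_, he a⟩) (hxt a), hxt, ?_⟩
    refine squeeze_zero (fun a => Real.iSup_nonneg fun n => norm_nonneg _)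
      (fun a => ciSup_le fun n => ?_) h
    simpa using he a n
  · rintro ⟨xt, hxt, hnull, h⟩
    refine squeeze_zero (fun a => (hx.1.sub (hxa a).1).netSeminorm_nonneg) (fun a => ?_) h
    have hb : UniformlyBounded (x - xt a) := hx.1.sub (hxt a).1
    have hsub : IsNullNet ((x - xa a) - (x - xt a)) := by
      rw [sub_sub_sub_cancel_left]
      exact hnull a
    refine (hsub.netSeminorm_le hb).trans
      (netSeminorm_le_of_eventually_le (Eventually.of_forall fun n => ?_))
    obtain ⟨C, hC⟩ := hb
    exact le_ciSup (f := fun n => ‖x n - xt a n‖) ⟨C, by rintro _ ⟨n, rfl⟩; exact hC n⟩ n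
end

section
/- Let (E,j) and (Ẽ,j̃) be soft inductive systems of Banach spaces over the same directed set N, and let T_• be a uniformly bounded net of linear operators T_n : E_n → Ẽ_n. Then: (1) if T_• maps every basic net j_{•m}x_m to a j̃-convergent net, then T_• maps every j-convergent net to a j̃-convergent net; (2) T_• maps every j-convergent net to a j̃-convergent net if and only if lim_m limsup_n ‖(j̃_{nm} T_m − T_n j_{nm}) x_m‖ = 0 for every j-convergent net x_•. -/
open Filter Topology MeasureTheory

variable {N : Type*} [Preorder N] [IsDirected N (· ≤ ·)] [Nonempty N]
variable {E : N → Type*} [∀ n, NormedAddCommGroup (E n)] [∀ n, NormedSpace ℂ (E n)]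
  [∀ n, CompleteSpace (E n)]

theorem limsup_le_of_eventually_le_of_nonneg {f : N → ℝ} (h0 : ∀ n, 0 ≤ f n) {ε : ℝ}
    (h : ∀ᶠ n in atTop, f n ≤ ε) : limsup f atTop ≤ ε :=
  limsup_le_of_le (isCoboundedUnder_le_of_le atTop h0) h

theorem eventually_lt_of_limsup_lt_of_le {f : N → ℝ} {C : ℝ} (hC : ∀ n, f n ≤ C) {ε : ℝ}
    (h : limsup f atTop < ε) : ∀ᶠ n in atTop, f n < ε :=
  eventually_lt_of_limsup_lt h (isBoundedUnder_of ⟨C, hC⟩)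

/-- An iterated limit `lim_m limsup_n f m n = 0` of a nonnegative double net which is bounded
in `n`, expressed without `limsup`. -/
theorem tendsto_limsup_zero_iff {f : N → N → ℝ} (h0 : ∀ m n, 0 ≤ f m n)
    (hC : ∀ m, ∃ C, ∀ n, f m n ≤ C) :
    Tendsto (fun m => limsup (f m) atTop) atTop (𝓝 0) ↔
      ∀ ε : ℝ, 0 < ε → ∀ᶠ m in atTop, ∀ᶠ n in atTop, f m n < ε := by
  constructor
  · intro h ε hε
    filter_upwards [h.eventually_lt_const hε] with m hm
    obtain ⟨C, hC⟩ := hC m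
    exact eventually_lt_of_limsup_lt_of_le hC hm
  · intro h
    refine tendsto_order.2 ⟨fun a ha => Eventually.of_forall fun m => ?_, fun a ha => ?_⟩
    · obtain ⟨C, hC⟩ := hC m
      exact ha.trans_le (le_limsup_of_frequently_le (Frequently.of_forall (h0 m))
        (isBoundedUnder_of ⟨C, hC⟩))
    · filter_upwards [h (a / 2) (half_pos ha)] with m hm
      exact (limsup_le_of_eventually_le_of_nonneg (h0 m) (hm.mono fun _ h => h.le)).trans_lt
        (half_lt_self ha)

theorem IsSoftInductiveSystem.norm_map_le {j : ∀ n m : N, E m →L[ℂ] E n}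
    (hj : IsSoftInductiveSystem j) (n m : N) (x : E m) : ‖j n m x‖ ≤ ‖x‖ := by
  by_cases h : m ≤ n
  · exact hj.contraction n m h x
  · simp [hj.map_not_le n m h]

theorem IsSoftInductiveSystem.jConvergent_iff {j : ∀ n m : N, E m →L[ℂ] E n}
    (hj : IsSoftInductiveSystem j) {x : ∀ n, E n} (hx : UniformlyBounded x) :
    JConvergent j x ↔
      ∀ ε : ℝ, 0 < ε → ∃ (m : N) (ξ : E m), ∀ᶠ n in atTop, ‖x n - j n m ξ‖ < ε := by
  obtain ⟨C, hC⟩ := id hx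
  constructor
  · rintro ⟨-, h⟩ ε hε
    obtain ⟨m, ξ, h⟩ := h ε hε
    exact ⟨m, ξ, eventually_lt_of_limsup_lt_of_le (C := C + ‖ξ‖) (fun n =>
      (norm_sub_le _ _).trans (add_le_add (hC n) (hj.norm_map_le n m ξ))) h⟩
  · refine fun h => ⟨hx, fun ε hε => ?_⟩
    obtain ⟨m, ξ, h⟩ := h (ε / 2) (half_pos hε)
    exact ⟨m, ξ, (limsup_le_of_eventually_le_of_nonneg (fun _ => norm_nonneg _)
      (h.mono fun _ h => h.le)).trans_lt (half_lt_self hε)⟩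

theorem IsSoftInductiveSystem.eventually_norm_map_sub_lt {j : ∀ n m : N, E m →L[ℂ] E n}
    (hj : IsSoftInductiveSystem j) (l : N) (ξ : E l) {ε : ℝ} (hε : 0 < ε) :
    ∀ᶠ m in atTop, ∀ᶠ n in atTop, ‖j n l ξ - j n m (j m l ξ)‖ < ε :=
  (tendsto_limsup_zero_iff (f := fun m n => ‖j n l ξ - j n m (j m l ξ)‖)
    (fun _ _ => norm_nonneg _) (fun m => ⟨‖ξ‖ + ‖j m l ξ‖, fun n => (norm_sub_le _ _).trans
      (add_le_add (hj.norm_map_le n l ξ) (hj.norm_map_le n m _))⟩)).1 (hj.soft l ξ) ε hε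

/-- A `j`-convergent net is asymptotically approximated by the basic nets of its own entries. -/
theorem JConvergent.eventually_norm_sub_lt {j : ∀ n m : N, E m →L[ℂ] E n} {x : ∀ n, E n}
    (hx : JConvergent j x) (hj : IsSoftInductiveSystem j) {ε : ℝ} (hε : 0 < ε) :
    ∀ᶠ m in atTop, ∀ᶠ n in atTop, ‖x n - j n m (x m)‖ < ε := by
  obtain ⟨l, ξ, h⟩ := (hj.jConvergent_iff hx.1).1 hx (ε / 3) (by positivity)
  filter_upwards [h, hj.eventually_norm_map_sub_lt l ξ (ε := ε / 3) (by positivity)]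
    with m hm hm'
  filter_upwards [h, hm'] with n hn hn'
  have h3 : ‖j n m (x m - j m l ξ)‖ < ε / 3 := (hj.norm_map_le n m _).trans_lt hm
  have key : x n - j n m (x m)
      = (x n - j n l ξ) + (j n l ξ - j n m (j m l ξ)) - j n m (x m - j m l ξ) := by
    rw [map_sub]; abel
  rw [key]
  linarith [norm_sub_le ((x n - j n l ξ) + (j n l ξ - j n m (j m l ξ))) (j n m (x m - j m l ξ)),
    norm_add_le (x n - j n l ξ) (j n l ξ - j n m (j m l ξ))]

/-- For a uniformly bounded net of operators `T n : E n → Ẽ n`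
between soft inductive systems: (1) if `T` maps every basic net to a
`j̃`-convergent net then it maps every `j`-convergent net to a `j̃`-convergent net;
(2) `T` maps `j`-convergent nets to `j̃`-convergent nets iff
`lim_m limsup_n ‖(j̃ n m ∘ T m - T n ∘ j n m) (x m)‖ = 0` for every `j`-convergent
net `x`. -/
theorem jj_convergence_criterion
    {E' : N → Type*} [∀ n, NormedAddCommGroup (E' n)] [∀ n, NormedSpace ℂ (E' n)]
    [∀ n, CompleteSpace (E' n)]
    (j : ∀ n m : N, E m →L[ℂ] E n) (j' : ∀ n m : N, E' m →L[ℂ] E' n)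
    (hj : IsSoftInductiveSystem j) (hj' : IsSoftInductiveSystem j')
    (T : ∀ n, E n →L[ℂ] E' n) (hTb : ∃ C : ℝ, ∀ n, ‖T n‖ ≤ C) :
    ((∀ (m : N) (ξ : E m), JConvergent j' (fun n => T n (j n m ξ))) →
      ∀ x : ∀ n, E n, JConvergent j x → JConvergent j' (fun n => T n (x n))) ∧
    ((∀ x : ∀ n, E n, JConvergent j x → JConvergent j' (fun n => T n (x n))) ↔
      ∀ x : ∀ n, E n, JConvergent j x →
        Tendsto (fun m => limsup
            (fun n => ‖j' n m (T m (x m)) - T n (j n m (x m))‖) atTop)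
          atTop (𝓝 0)) := by
  obtain ⟨C, hCpos, hT⟩ : ∃ C : ℝ, 0 < C ∧ ∀ n (ξ : E n), ‖T n ξ‖ ≤ C * ‖ξ‖ := by
    obtain ⟨C, hC⟩ := hTb
    exact ⟨max C 1, by positivity, fun n ξ =>
      (T n).le_of_opNorm_le ((hC n).trans (le_max_left _ _)) ξ⟩
  have hTlt : ∀ {ε : ℝ} {n} {ξ : E n}, ‖ξ‖ < ε / 2 / C → ‖T n ξ‖ < ε / 2 := by
    intro ε n ξ h
    rw [lt_div_iff₀ hCpos, mul_comm] at h
    exact (hT n ξ).trans_lt h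
  have hTx : ∀ {x : ∀ n, E n}, UniformlyBounded x → UniformlyBounded fun n => T n (x n) := by
    rintro x ⟨B, hB⟩
    exact ⟨C * B, fun n => (hT n _).trans (by gcongr; exact hB n)⟩
  have hlim : ∀ x : ∀ n, E n,
      Tendsto (fun m => limsup (fun n => ‖j' n m (T m (x m)) - T n (j n m (x m))‖) atTop)
        atTop (𝓝 0) ↔ ∀ ε : ℝ, 0 < ε → ∀ᶠ m in atTop, ∀ᶠ n in atTop,
          ‖j' n m (T m (x m)) - T n (j n m (x m))‖ < ε := fun x =>
    tendsto_limsup_zero_iff (f := fun m n => ‖j' n m (T m (x m)) - T n (j n m (x m))‖)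
      (fun _ _ => norm_nonneg _) fun m => ⟨‖T m (x m)‖ + C * ‖x m‖, fun n =>
        (norm_sub_le _ _).trans (add_le_add (hj'.norm_map_le n m _)
          ((hT n _).trans (by gcongr; exact hj.norm_map_le n m _)))⟩
  refine ⟨fun h x hx => (hj'.jConvergent_iff (hTx hx.1)).2 fun ε hε => ?_,
    fun h x hx => (hlim x).2 fun ε hε => ?_,
    fun h x hx => (hj'.jConvergent_iff (hTx hx.1)).2 fun ε hε => ?_⟩
  · obtain ⟨m, ξ, hξ⟩ := (hj.jConvergent_iff hx.1).1 hx (ε / 2 / C) (by positivity)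
    obtain ⟨k, η, hη⟩ := (hj'.jConvergent_iff (h m ξ).1).1 (h m ξ) (ε / 2) (by positivity)
    refine ⟨k, η, ?_⟩
    filter_upwards [hξ, hη] with n hn hn'
    have key : T n (x n) - j' n k η = T n (x n - j n m ξ) + (T n (j n m ξ) - j' n k η) := by
      rw [map_sub]; abel
    rw [key]
    linarith [norm_add_le (T n (x n - j n m ξ)) (T n (j n m ξ) - j' n k η), hTlt hn]
  · filter_upwards [hx.eventually_norm_sub_lt hj (ε := ε / 2 / C) (by positivity),
      (h x hx).eventually_norm_sub_lt hj' (half_pos hε)] with m hm hm'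
    filter_upwards [hm, hm'] with n hn hn'
    have key : j' n m (T m (x m)) - T n (j n m (x m))
        = T n (x n - j n m (x m)) - (T n (x n) - j' n m (T m (x m))) := by
      rw [map_sub]; abel
    rw [key]
    linarith [norm_sub_le (T n (x n - j n m (x m))) (T n (x n) - j' n m (T m (x m))), hTlt hn]
  · obtain ⟨m, hm, hm'⟩ := ((hx.eventually_norm_sub_lt hj (ε := ε / 2 / C)
      (by positivity)).and ((hlim x).1 (h x hx) (ε / 2) (half_pos hε))).exists
    refine ⟨m, T m (x m), ?_⟩
    filter_upwards [hm, hm'] with n hn hn'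
    have key : T n (x n) - j' n m (T m (x m))
        = T n (x n - j n m (x m)) - (j' n m (T m (x m)) - T n (j n m (x m))) := by
      rw [map_sub]; abel
    rw [key]
    linarith [norm_sub_le (T n (x n - j n m (x m))) (j' n m (T m (x m)) - T n (j n m (x m))),
      hTlt hn]
end
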